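/- arXiv:2004.02265 — 2 statements merged into one kernel-verified Lean document; each statement's English description precedes it below -/
import Mathlib

section
/- For every t > 0 and every integer a, ∫_{B_a} ρ(t,x) dμ(x) = exp(−σ·t·p^{−ab}) + Σ_{r ≤ −a−1} p^{a+r}·(exp(−σ·t·p^{rb}) − exp(−σ·t·p^{(r+1)b})), where the sum runs over all integers r ≤ −a−1. -/
open MeasureTheory

/-- The fundamental solution `ρ(t,x)` of the p-adic diffusion equation with diffusion
constant `σ` and Vladimirov exponent `b`:
`ρ(t,x) = Σ_{r∈ℤ} (exp(−σ t p^{rb}) − exp(−σ t p^{(r+1)b})) p^r 1_{B_{−r}}(x)`. -/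
noncomputable def rho (p : ℕ) [Fact p.Prime] (σ b : ℝ) (t : ℝ) (x : ℚ_[p]) : ℝ :=
  ∑' r : ℤ,
    (Real.exp (-(σ * t * (p : ℝ) ^ ((r : ℝ) * b))) -
      Real.exp (-(σ * t * (p : ℝ) ^ (((r : ℝ) + 1) * b)))) *
    (p : ℝ) ^ (r : ℤ) *
    Set.indicator {y : ℚ_[p] | ‖y‖ ≤ (p : ℝ) ^ (-r : ℤ)} (fun _ => 1) x

open Filter Topology

lemma Padic.closedBall_succ_eq_iUnion (p : ℕ) [Fact p.Prime] (n : ℤ) :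
    {x : ℚ_[p] | ‖x‖ ≤ (p : ℝ) ^ (n + 1)} =
      ⋃ i ∈ Finset.range p,
        (fun x : ℚ_[p] => x + -((i : ℚ_[p]) * (p : ℚ_[p]) ^ (-(n + 1)))) ⁻¹'
          {x : ℚ_[p] | ‖x‖ ≤ (p : ℝ) ^ n} := by
  have hp : 1 < (p : ℝ) := mod_cast (Fact.out : p.Prime).one_lt
  have hp0 : (p : ℝ) ≠ 0 := by positivity
  have hpQ : (p : ℚ_[p]) ≠ 0 := mod_cast (Fact.out : p.Prime).ne_zero
  ext x
  simp only [Set.mem_ofPred_eq, Set.mem_iUnion, Finset.mem_range, Set.mem_preimage, exists_prop,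
    ← sub_eq_add_neg]
  constructor
  · intro hx
    have hy : ‖x * (p : ℚ_[p]) ^ (n + 1)‖ ≤ 1 := by
      rw [norm_mul, Padic.norm_p_zpow]
      calc ‖x‖ * (p : ℝ) ^ (-(n + 1)) ≤ (p : ℝ) ^ (n + 1) * (p : ℝ) ^ (-(n + 1)) := by gcongr
        _ = 1 := by rw [← zpow_add₀ hp0]; simp
    let y : ℤ_[p] := ⟨x * (p : ℚ_[p]) ^ (n + 1), hy⟩
    refine ⟨y.zmodRepr, y.zmodRepr_lt_p, ?_⟩
    have h := y.norm_sub_zmodRepr_lt_one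
    rw [PadicInt.norm_def] at h
    push_cast at h
    rw [Padic.norm_le_pow_iff_norm_lt_pow_add_one]
    have e : x - (y.zmodRepr : ℚ_[p]) * (p : ℚ_[p]) ^ (-(n + 1)) =
        (x * (p : ℚ_[p]) ^ (n + 1) - y.zmodRepr) * (p : ℚ_[p]) ^ (-(n + 1)) := by
      rw [sub_mul, mul_assoc, ← zpow_add₀ hpQ]; simp
    rw [e, norm_mul, Padic.norm_p_zpow, neg_neg]
    exact mul_lt_of_lt_one_left (by positivity) h
  · rintro ⟨i, -, hi⟩
    rw [← sub_add_cancel x ((i : ℚ_[p]) * (p : ℚ_[p]) ^ (-(n + 1)))]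
    refine (Padic.nonarchimedean _ _).trans (max_le (hi.trans ?_) ?_)
    · exact zpow_le_zpow_right₀ hp.le (by lia)
    · rw [norm_mul, Padic.norm_p_zpow, neg_neg]
      exact mul_le_of_le_one_left (by positivity) (by simpa using Padic.norm_int_le_one (p := p) i)

lemma Padic.pairwiseDisjoint_translates (p : ℕ) [Fact p.Prime] (n : ℤ) :
    ((Finset.range p : Finset ℕ) : Set ℕ).PairwiseDisjoint fun i =>
      (fun x : ℚ_[p] => x + -((i : ℚ_[p]) * (p : ℚ_[p]) ^ (-(n + 1)))) ⁻¹'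
        {x : ℚ_[p] | ‖x‖ ≤ (p : ℝ) ^ n} := by
  intro i hi j hj hij
  refine Set.disjoint_left.2 fun x hxi hxj => hij ?_
  simp only [Set.mem_preimage, Set.mem_ofPred_eq, ← sub_eq_add_neg] at hxi hxj
  simp only [Finset.coe_range, Set.mem_Iio] at hi hj
  have hp0 : 0 < (p : ℝ) := mod_cast (Fact.out : p.Prime).pos
  have h : ‖((i : ℚ_[p]) - j) * (p : ℚ_[p]) ^ (-(n + 1))‖ ≤ (p : ℝ) ^ n := by
    have e : ((i : ℚ_[p]) - j) * (p : ℚ_[p]) ^ (-(n + 1)) =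
        (x - j * (p : ℚ_[p]) ^ (-(n + 1))) - (x - i * (p : ℚ_[p]) ^ (-(n + 1))) := by ring
    rw [e, sub_eq_add_neg (x - _)]
    exact (Padic.nonarchimedean _ _).trans (max_le hxj (by rwa [norm_neg]))
  rw [Padic.norm_le_pow_iff_norm_lt_pow_add_one, norm_mul, Padic.norm_p_zpow, neg_neg,
    mul_lt_iff_lt_one_left (by positivity)] at h
  have hdvd : (p : ℤ) ∣ (i : ℤ) - j := by
    rw [← Padic.norm_intCast_lt_one_iff (p := p)]
    exact_mod_cast h
  have hmod : j ≡ i [MOD p] := (Nat.modEq_iff_dvd).2 hdvd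
  exact (hmod.eq_of_lt_of_lt hj hi).symm

section Measure

variable {p : ℕ} [Fact p.Prime] [MeasurableSpace ℚ_[p]] [BorelSpace ℚ_[p]]

lemma Padic.measurableSet_norm_le (r : ℝ) : MeasurableSet {x : ℚ_[p] | ‖x‖ ≤ r} :=
  measurableSet_le measurable_norm measurable_const

variable (μ : Measure ℚ_[p]) [μ.IsAddHaarMeasure]

lemma Padic.measureReal_norm_le_succ (n : ℤ) :
    μ.real {x : ℚ_[p] | ‖x‖ ≤ (p : ℝ) ^ (n + 1)} =
      p * μ.real {x : ℚ_[p] | ‖x‖ ≤ (p : ℝ) ^ n} := by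
  rw [Measure.real, Padic.closedBall_succ_eq_iUnion, measure_biUnion_finset
    (Padic.pairwiseDisjoint_translates p n)
    fun i _ => (measurable_add_const _) (Padic.measurableSet_norm_le _)]
  simp only [measure_preimage_add_right, Finset.sum_const, Finset.card_range, nsmul_eq_mul,
    ENNReal.toReal_mul, ENNReal.toReal_natCast, Measure.real]

lemma Padic.measureReal_norm_le_zpow (hμ : μ {x : ℚ_[p] | ‖x‖ ≤ 1} = 1) (n : ℤ) :
    μ.real {x : ℚ_[p] | ‖x‖ ≤ (p : ℝ) ^ n} = (p : ℝ) ^ n := by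
  have hp0 : (p : ℝ) ≠ 0 := mod_cast (Fact.out : p.Prime).ne_zero
  induction n with
  | zero => simp [Measure.real, hμ]
  | succ n ih => rw [Padic.measureReal_norm_le_succ, ih, zpow_add_one₀ hp0, mul_comm]
  | pred n ih =>
    have h := Padic.measureReal_norm_le_succ μ (-(n : ℤ) - 1)
    rw [sub_add_cancel, ih] at h
    refine mul_left_cancel₀ hp0 (h.symm.trans ?_)
    rw [← zpow_one_add₀ hp0, add_sub_cancel]

end Measure

lemma Antitone.hasSum_sub_add_natCast {c : ℤ → ℝ} (hc : Antitone c) {l : ℝ}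
    (h : Tendsto c atTop (𝓝 l)) (k : ℤ) :
    HasSum (fun n : ℕ => c (k + n) - c (k + n + 1)) (c k - l) := by
  rw [hasSum_iff_tendsto_nat_of_nonneg fun n => sub_nonneg.2 (hc (by lia))]
  have e (n : ℕ) : ∑ i ∈ Finset.range n, (c (k + i) - c (k + i + 1)) = c k - c (k + n) := by
    simpa [add_assoc] using Finset.sum_range_sub' (fun i : ℕ => c (k + i)) n
  simp_rw [e]
  exact tendsto_const_nhds.sub
    (h.comp (tendsto_atTop_add_const_left _ k tendsto_natCast_atTop_atTop))

lemma Antitone.summable_sub_succ {c : ℤ → ℝ} (hc : Antitone c) {l u : ℝ}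
    (h : Tendsto c atTop (𝓝 l)) (hu : ∀ r, c r ≤ u) :
    Summable fun r => c r - c (r + 1) := by
  refine Summable.of_nat_of_neg_add_one ?_ ?_
  · simpa using (hc.hasSum_sub_add_natCast h 0).summable
  · refine summable_of_sum_range_le (c := u - c 0) (fun n => sub_nonneg.2 (hc (by lia)))
      fun n => ?_
    have e : ∑ i ∈ Finset.range n, (c (-((i : ℤ) + 1)) - c (-((i : ℤ) + 1) + 1)) =
        c (-(n : ℤ)) - c 0 := by
      simpa [add_comm] using Finset.sum_range_sub (fun i : ℕ => c (-(i : ℤ))) n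
    rw [e]
    linarith [hu (-(n : ℤ))]

/-- The restriction of `∑ (c r - c (r + 1))` to the integers `r ≥ k` telescopes. -/
lemma Antitone.tsum_sub_succ_compl_Iic {c : ℤ → ℝ} (hc : Antitone c)
    (h : Tendsto c atTop (𝓝 0)) (k : ℤ) :
    ∑' r : ↑({r : ℤ | r ≤ k - 1}ᶜ), (c r - c (r + 1)) = c k := by
  let e : ℕ ≃ ↑({r : ℤ | r ≤ k - 1}ᶜ) :=
    { toFun n := ⟨k + n, by simp⟩
      invFun r := (r.1 - k).toNat
      left_inv n := by simp
      right_inv r := by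
        obtain ⟨r, hr⟩ := r
        simp only [Set.mem_compl_iff, Set.mem_ofPred_eq] at hr
        ext
        simp
        lia }
  rw [← e.tsum_eq]
  exact (hc.hasSum_sub_add_natCast h k).tsum_eq.trans (sub_zero _)

lemma antitone_exp_neg_mul_rpow {q s b : ℝ} (hq : 1 < q) (hs : 0 < s) (hb : 0 < b) :
    Antitone fun r : ℤ => Real.exp (-(s * q ^ ((r : ℝ) * b))) := by
  intro r r' h
  have h' : (r : ℝ) ≤ r' := mod_cast h
  dsimp only
  gcongr
  exact hq.le

lemma tendsto_exp_neg_mul_rpow {q s b : ℝ} (hq : 1 < q) (hs : 0 < s) (hb : 0 < b) :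
    Tendsto (fun r : ℤ => Real.exp (-(s * q ^ ((r : ℝ) * b)))) atTop (𝓝 0) := by
  refine Real.tendsto_exp_neg_atTop_nhds_zero.comp (Tendsto.const_mul_atTop hs ?_)
  exact (tendsto_rpow_atTop_of_base_gt_one q hq).comp
    (tendsto_intCast_atTop_atTop.atTop_mul_const hb)

/-- For every `t > 0` and every integer `a`,
`∫_{B_a} ρ(t,x) dμ(x) = exp(−σ t p^{−ab}) + Σ_{r ≤ −a−1} p^{a+r}(exp(−σ t p^{rb}) − exp(−σ t p^{(r+1)b}))`,
the sum running over all integers `r ≤ −a−1`. -/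
theorem exit_prob_statement_5 (p : ℕ) [Fact p.Prime]
    [MeasurableSpace ℚ_[p]] [BorelSpace ℚ_[p]]
    (μ : Measure ℚ_[p]) [μ.IsAddHaarMeasure]
    (hμ : μ {x : ℚ_[p] | ‖x‖ ≤ 1} = 1)
    (σ b : ℝ) (hσ : 0 < σ) (hb : 0 < b)
    (t : ℝ) (ht : 0 < t) (a : ℤ) :
    ∫ x in {x : ℚ_[p] | ‖x‖ ≤ (p : ℝ) ^ a}, rho p σ b t x ∂μ =
      Real.exp (-(σ * t * (p : ℝ) ^ (-((a : ℝ) * b)))) +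
      ∑' r : {r : ℤ // r ≤ -a - 1},
        (p : ℝ) ^ (a + (r : ℤ)) *
          (Real.exp (-(σ * t * (p : ℝ) ^ (((r : ℤ) : ℝ) * b))) -
            Real.exp (-(σ * t * (p : ℝ) ^ ((((r : ℤ) : ℝ) + 1) * b)))) := by
  set c : ℤ → ℝ := fun r => Real.exp (-(σ * t * (p : ℝ) ^ ((r : ℝ) * b))) with hc
  have hp : 1 < (p : ℝ) := mod_cast (Fact.out : p.Prime).one_lt
  have hp0 : (p : ℝ) ≠ 0 := by positivity
  have hanti : Antitone c := antitone_exp_neg_mul_rpow hp (mul_pos hσ ht) hb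
  have hlim : Tendsto c atTop (𝓝 0) := tendsto_exp_neg_mul_rpow hp (mul_pos hσ ht) hb
  have hc1 (r : ℤ) : c r ≤ 1 := Real.exp_le_one_iff.2 (by simp only [neg_nonpos]; positivity)
  have hsum := hanti.summable_sub_succ hlim hc1
  have hnonneg (r : ℤ) : 0 ≤ c r - c (r + 1) := sub_nonneg.2 (hanti (by lia))
  set F : ℤ → ℚ_[p] → ℝ := fun r => {y : ℚ_[p] | ‖y‖ ≤ (p : ℝ) ^ (-r)}.indicator
    fun _ => (c r - c (r + 1)) * (p : ℝ) ^ r with hF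
  have hrho (x : ℚ_[p]) : rho p σ b t x = ∑' r, F r x := by
    refine tsum_congr fun r => ?_
    simp only [hF, hc, Set.indicator_apply]
    push_cast
    split_ifs <;> simp
  have hFnonneg (r : ℤ) (x : ℚ_[p]) : 0 ≤ F r x :=
    Set.indicator_nonneg (fun _ _ => mul_nonneg (hnonneg r) (by positivity)) x
  have hfin (n : ℤ) : μ {x : ℚ_[p] | ‖x‖ ≤ (p : ℝ) ^ n} ≠ ⊤ := by
    intro h
    have h' := Padic.measureReal_norm_le_zpow μ hμ n
    rw [Measure.real, h, ENNReal.toReal_top] at h'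
    exact zpow_ne_zero n hp0 h'.symm
  have hFint (r : ℤ) : Integrable (F r) (μ.restrict {x : ℚ_[p] | ‖x‖ ≤ (p : ℝ) ^ a}) :=
    ((integrable_indicator_iff (Padic.measurableSet_norm_le _)).2
      (integrableOn_const (hfin _))).restrict
  have hint (r : ℤ) : ∫ x in {x : ℚ_[p] | ‖x‖ ≤ (p : ℝ) ^ a}, F r x ∂μ =
      (c r - c (r + 1)) * (p : ℝ) ^ (min (a + r) 0) := by
    have hinter : {x : ℚ_[p] | ‖x‖ ≤ (p : ℝ) ^ a} ∩ {x : ℚ_[p] | ‖x‖ ≤ (p : ℝ) ^ (-r)} =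
        {x : ℚ_[p] | ‖x‖ ≤ (p : ℝ) ^ (min a (-r))} := by
      ext x
      rw [(zpow_right_mono₀ hp.le).map_min]
      simp
    rw [setIntegral_indicator (Padic.measurableSet_norm_le _), hinter, setIntegral_const,
      Padic.measureReal_norm_le_zpow μ hμ, smul_eq_mul, mul_comm, mul_assoc, ← zpow_add₀ hp0]
    congr 2
    lia
  have hG : Summable fun r => (c r - c (r + 1)) * (p : ℝ) ^ (min (a + r) 0) :=
    hsum.of_nonneg_of_le (fun r => mul_nonneg (hnonneg r) (by positivity)) fun r =>
      mul_le_of_le_one_right (hnonneg r) (zpow_le_one_of_nonpos₀ hp.le (min_le_right _ _))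
  simp_rw [hrho]
  rw [← integral_tsum_of_summable_integral_norm hFint
    (by simpa only [Real.norm_of_nonneg (hFnonneg _ _), hint] using hG)]
  simp_rw [hint]
  rw [← hG.tsum_subtype_add_tsum_subtype_compl {r : ℤ | r ≤ -a - 1}, add_comm]
  congr 1
  · rw [show Real.exp (-(σ * t * (p : ℝ) ^ (-((a : ℝ) * b)))) = c (-a) by simp [hc],
      ← hanti.tsum_sub_succ_compl_Iic hlim (-a)]
    refine tsum_congr fun r => ?_
    have hr : ¬ (r : ℤ) ≤ -a - 1 := r.2
    rw [min_eq_right (by lia), zpow_zero, mul_one]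
  · refine tsum_congr fun r => ?_
    have hr : (r : ℤ) ≤ -a - 1 := r.2
    rw [min_eq_left (by lia), mul_comm]
    simp [hc]
end

section
/- For every real T > 0 and every integer a, lim_{n→∞} (∫_{B_a} ρ(T/n, x) dμ(x))^n = exp(−σ·α·T·p^{−ab}), where α := 1 − (p^b − 1)/(p^{b+1} − 1). (This limit is the probability that a p-adic Brownian path with diffusion constant σ and Vladimirov exponent b, started at 0, remains in the ball B_a up to time T; this is the content of the paper's main Theorem on first exit probabilities.) -/
open MeasureTheory Filter

/-- A closed ball of radius `p ^ (r + 1)` is a union of `p` translates of the ball of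
radius `p ^ r`. -/
lemma Padic.setOf_norm_le_zpow_succ (p : ℕ) [Fact p.Prime] (r : ℤ) :
    {x : ℚ_[p] | ‖x‖ ≤ (p : ℝ) ^ (r + 1)} =
      ⋃ i ∈ Finset.range p,
        (fun x : ℚ_[p] => -((i : ℚ_[p]) * (p : ℚ_[p]) ^ (-(r + 1))) + x) ⁻¹'
          {x : ℚ_[p] | ‖x‖ ≤ (p : ℝ) ^ r} := by
  have hp : (p : ℚ_[p]) ≠ 0 := Nat.cast_ne_zero.2 (Fact.out : p.Prime).ne_zero
  have hpos : (0 : ℝ) < p := Nat.cast_pos.2 (Fact.out : p.Prime).pos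
  have hnorm : ‖(p : ℚ_[p]) ^ (-(r + 1))‖ = (p : ℝ) ^ (r + 1) := by
    rw [Padic.norm_p_zpow, neg_neg]
  ext x
  simp only [Set.mem_ofPred_eq, Set.mem_iUnion, Set.mem_preimage, Finset.mem_range, exists_prop]
  constructor
  · intro hx
    have hy : ‖x * (p : ℚ_[p]) ^ (r + 1)‖ ≤ 1 := by
      rw [norm_mul, Padic.norm_p_zpow, zpow_neg, ← div_eq_mul_inv]
      exact div_le_one_of_le₀ hx (by positivity)
    let y : ℤ_[p] := ⟨x * (p : ℚ_[p]) ^ (r + 1), hy⟩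
    refine ⟨y.zmodRepr, y.zmodRepr_lt_p, ?_⟩
    have hlt := y.norm_sub_zmodRepr_lt_one
    rw [PadicInt.norm_def] at hlt
    rw [Padic.norm_le_pow_iff_norm_lt_pow_add_one]
    have hfac : -((y.zmodRepr : ℚ_[p]) * (p : ℚ_[p]) ^ (-(r + 1))) + x =
        ((y - y.zmodRepr : ℤ_[p]) : ℚ_[p]) * (p : ℚ_[p]) ^ (-(r + 1)) := by
      have hxy : ((y : ℤ_[p]) : ℚ_[p]) * (p : ℚ_[p]) ^ (-(r + 1)) = x := by
        change x * (p : ℚ_[p]) ^ (r + 1) * (p : ℚ_[p]) ^ (-(r + 1)) = x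
        rw [mul_assoc, ← zpow_add₀ hp, add_neg_cancel, zpow_zero, mul_one]
      push_cast
      rw [sub_mul, hxy]
      ring
    rw [hfac, norm_mul, hnorm]
    exact mul_lt_of_lt_one_left (by positivity) hlt
  · rintro ⟨i, -, hi⟩
    have hle : (p : ℝ) ^ r ≤ (p : ℝ) ^ (r + 1) :=
      zpow_le_zpow_right₀ (Nat.one_le_cast.2 (Fact.out : p.Prime).one_le) (by lia)
    have hterm : ‖(i : ℚ_[p]) * (p : ℚ_[p]) ^ (-(r + 1))‖ ≤ (p : ℝ) ^ (r + 1) := by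
      rw [norm_mul, hnorm]
      exact mul_le_of_le_one_left (by positivity) (by simpa using Padic.norm_int_le_one (p := p) i)
    calc ‖x‖ = ‖(i : ℚ_[p]) * (p : ℚ_[p]) ^ (-(r + 1)) +
          (-((i : ℚ_[p]) * (p : ℚ_[p]) ^ (-(r + 1))) + x)‖ := by congr 1; ring
      _ ≤ _ := (Padic.nonarchimedean _ _).trans (max_le hterm (hi.trans hle))

lemma Padic.measurableSet_setOf_norm_le (p : ℕ) [Fact p.Prime]
    [MeasurableSpace ℚ_[p]] [BorelSpace ℚ_[p]] (c : ℝ) :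
    MeasurableSet {x : ℚ_[p] | ‖x‖ ≤ c} :=
  (isClosed_le continuous_norm continuous_const).measurableSet

lemma Padic.measure_setOf_norm_le_ne_top (p : ℕ) [Fact p.Prime]
    [MeasurableSpace ℚ_[p]] [BorelSpace ℚ_[p]]
    (μ : Measure ℚ_[p]) [μ.IsAddHaarMeasure] (c : ℝ) :
    μ {x : ℚ_[p] | ‖x‖ ≤ c} ≠ ⊤ := by
  have h := (isCompact_closedBall (0 : ℚ_[p]) c).measure_ne_top (μ := μ)
  simpa [Metric.closedBall] using h

lemma Padic.measureReal_setOf_norm_le_zpow_succ (p : ℕ) [Fact p.Prime]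
    [MeasurableSpace ℚ_[p]] [BorelSpace ℚ_[p]]
    (μ : Measure ℚ_[p]) [μ.IsAddHaarMeasure] (r : ℤ) :
    μ.real {x : ℚ_[p] | ‖x‖ ≤ (p : ℝ) ^ (r + 1)} =
      p * μ.real {x : ℚ_[p] | ‖x‖ ≤ (p : ℝ) ^ r} := by
  have hpos : (0 : ℝ) < p := Nat.cast_pos.2 (Fact.out : p.Prime).pos
  rw [measureReal_def, measureReal_def, Padic.setOf_norm_le_zpow_succ, measure_biUnion_finset]
  · simp only [measure_preimage_add]
    simp
  · intro i hi j hj hij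
    rw [Function.onFun, Set.disjoint_left]
    intro x hxi hxj
    simp only [Set.mem_preimage, Set.mem_ofPred_eq] at hxi hxj
    have hle : ‖((i : ℚ_[p]) - j) * (p : ℚ_[p]) ^ (-(r + 1))‖ ≤ (p : ℝ) ^ r := by
      have hsub := (Padic.nonarchimedean
        (-((j : ℚ_[p]) * (p : ℚ_[p]) ^ (-(r + 1))) + x)
        (-(-((i : ℚ_[p]) * (p : ℚ_[p]) ^ (-(r + 1))) + x))).trans
          (max_le hxj (by rwa [norm_neg]))
      have heq : -((j : ℚ_[p]) * (p : ℚ_[p]) ^ (-(r + 1))) + x +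
          -(-((i : ℚ_[p]) * (p : ℚ_[p]) ^ (-(r + 1))) + x) =
          ((i : ℚ_[p]) - j) * (p : ℚ_[p]) ^ (-(r + 1)) := by ring
      rwa [heq] at hsub
    rw [Padic.norm_le_pow_iff_norm_lt_pow_add_one, norm_mul, Padic.norm_p_zpow, neg_neg,
      mul_lt_iff_lt_one_left (by positivity)] at hle
    have hdvd : (p : ℤ) ∣ (i : ℤ) - j := by
      rw [← Padic.norm_intCast_lt_one_iff]
      exact_mod_cast hle
    have hmod := Nat.modEq_iff_dvd.2 hdvd
    exact hij (hmod.eq_of_lt_of_lt (Finset.mem_range.1 hj) (Finset.mem_range.1 hi)).symm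
  · intro i _
    exact (Padic.measurableSet_setOf_norm_le p _).preimage (measurable_const_add _)

lemma Padic.measureReal_setOf_norm_le_zpow (p : ℕ) [Fact p.Prime]
    [MeasurableSpace ℚ_[p]] [BorelSpace ℚ_[p]]
    (μ : Measure ℚ_[p]) [μ.IsAddHaarMeasure]
    (hμ : μ {x : ℚ_[p] | ‖x‖ ≤ 1} = 1) (r : ℤ) :
    μ.real {x : ℚ_[p] | ‖x‖ ≤ (p : ℝ) ^ r} = (p : ℝ) ^ r := by
  have hp : (p : ℝ) ≠ 0 := Nat.cast_ne_zero.2 (Fact.out : p.Prime).ne_zero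
  induction r with
  | zero => simp [measureReal_def, hμ]
  | succ n ih => rw [Padic.measureReal_setOf_norm_le_zpow_succ, ih, zpow_add_one₀ hp, mul_comm]
  | pred n ih =>
    have h := Padic.measureReal_setOf_norm_le_zpow_succ p μ (-n - 1)
    rw [sub_add_cancel, ih] at h
    refine mul_left_cancel₀ hp ?_
    rw [← h, ← zpow_one_add₀ hp, add_sub_cancel]

/-- The total mass a ball receives from the series defining `rho`, after rescaling time and
shifting the index; summation by parts turns it into a geometrically weighted sum. -/
lemma hasSum_exp_sub_exp_mul_zpow_min {P b s : ℝ} (hP : 1 < P) (hb : 0 < b) (hs : 0 < s) :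
    HasSum
      (fun m : ℤ => (Real.exp (-(s * P ^ ((m : ℝ) * b))) -
        Real.exp (-(s * P ^ (((m : ℝ) + 1) * b)))) * P ^ (min m 0))
      ((1 - P⁻¹) * ∑' k : ℕ, P⁻¹ ^ k * Real.exp (-(s * P ^ (-((k : ℝ) * b))))) := by
  have hP0 : 0 < P := zero_lt_one.trans hP
  have hinv : P⁻¹ < 1 := inv_lt_one_of_one_lt₀ hP
  have hsum : Summable fun k : ℕ => P⁻¹ ^ k * Real.exp (-(s * P ^ (-((k : ℝ) * b)))) := by
    refine (summable_geometric_of_lt_one (inv_nonneg.2 hP0.le) hinv).of_nonneg_of_le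
      (fun k => by positivity) fun k => ?_
    refine mul_le_of_le_one_right (by positivity) (Real.exp_le_one_iff.2 ?_)
    have : 0 ≤ s * P ^ (-((k : ℝ) * b)) := by positivity
    linarith
  have hmono : Monotone fun x : ℝ => P ^ (x * b) := fun x y hxy =>
    Real.rpow_le_rpow_of_exponent_le hP.le (by gcongr)
  have hpos : HasSum
      (fun m : ℕ => (Real.exp (-(s * P ^ (((m : ℤ) : ℝ) * b))) -
        Real.exp (-(s * P ^ ((((m : ℤ) : ℝ) + 1) * b)))) * P ^ (min (m : ℤ) 0))
      (Real.exp (-s)) := by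
    rw [hasSum_iff_tendsto_nat_of_nonneg]
    · have hlim : Tendsto (fun n : ℕ => Real.exp (-(s * P ^ ((n : ℝ) * b)))) atTop (nhds 0) := by
        refine Real.tendsto_exp_neg_atTop_nhds_zero.comp (Tendsto.const_mul_atTop hs ?_)
        have hbase : 1 < P ^ b := Real.one_lt_rpow hP hb
        refine (tendsto_pow_atTop_atTop_of_one_lt hbase).congr fun n => ?_
        rw [← Real.rpow_mul_natCast hP0.le, mul_comm]
      have hlim' := hlim.const_sub (Real.exp (-s))
      rw [sub_zero] at hlim'
      refine hlim'.congr fun n => ?_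
      have := Finset.sum_range_sub' (fun m : ℕ => Real.exp (-(s * P ^ ((m : ℝ) * b)))) n
      simpa using this.symm
    · intro m
      refine mul_nonneg (sub_nonneg.2 (Real.exp_le_exp.2 (neg_le_neg ?_))) (by positivity)
      exact mul_le_mul_of_nonneg_left (hmono (by linarith)) hs.le
  have hneg : HasSum
      (fun k : ℕ => (Real.exp (-(s * P ^ (((-((k : ℤ) + 1) : ℤ) : ℝ) * b))) -
        Real.exp (-(s * P ^ ((((-((k : ℤ) + 1) : ℤ) : ℝ) + 1) * b)))) *
          P ^ (min (-((k : ℤ) + 1)) 0))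
      (((∑' k : ℕ, P⁻¹ ^ k * Real.exp (-(s * P ^ (-((k : ℝ) * b))))) - Real.exp (-s)) -
        P⁻¹ * ∑' k : ℕ, P⁻¹ ^ k * Real.exp (-(s * P ^ (-((k : ℝ) * b))))) := by
    have hshift := (hasSum_nat_add_iff' 1).2 hsum.hasSum
    have h := hshift.sub (hsum.hasSum.mul_left P⁻¹)
    simp only [Finset.range_one, Finset.sum_singleton, pow_zero, Nat.cast_zero, zero_mul, neg_zero,
      Real.rpow_zero, mul_one, one_mul] at h
    refine (congrArg (fun f : ℕ → ℝ => HasSum f _) (funext fun k => ?_)).mpr h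
    rw [min_eq_left (by lia)]
    have e1 : (((-((k : ℤ) + 1) : ℤ) : ℝ) + 1) * b = -((k : ℝ) * b) := by push_cast; ring
    have e2 : ((-((k : ℤ) + 1) : ℤ) : ℝ) * b = -(((k + 1 : ℕ) : ℝ) * b) := by push_cast; ring
    have e3 : P ^ (-((k : ℤ) + 1)) = P⁻¹ ^ (k + 1) := by
      rw [zpow_neg, inv_pow]; norm_cast
    rw [e1, e2, e3]
    ring
  have h := HasSum.of_nat_of_neg_add_one (f := fun m : ℤ =>
    (Real.exp (-(s * P ^ ((m : ℝ) * b))) - Real.exp (-(s * P ^ (((m : ℝ) + 1) * b)))) *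
      P ^ (min m 0)) hpos hneg
  rwa [add_sub, add_sub_cancel, ← one_sub_mul] at h

/-- The first-order behaviour at `0` of the geometrically weighted sum of exponentials. -/
lemma tendsto_geometric_exp_pow {u q s : ℝ} (hu0 : 0 ≤ u) (hu1 : u < 1) (hq0 : 0 ≤ q)
    (hq1 : q ≤ 1) (hs : 0 ≤ s) :
    Tendsto (fun n : ℕ => ((1 - u) * ∑' k : ℕ, u ^ k * Real.exp (-(s / n * q ^ k))) ^ n) atTop
      (nhds (Real.exp (-(s * ((1 - u) / (1 - u * q)))))) := by
  have hgeo := summable_geometric_of_lt_one hu0 hu1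
  have huq : u * q < 1 := (mul_le_of_le_one_right hu0 hq1).trans_lt hu1
  have hpt (c : ℝ) : Tendsto (fun n : ℕ => (n : ℝ) * (Real.exp (-(c / n)) - 1)) atTop
      (nhds (-c)) := by
    have hderiv : HasDerivAt (fun t : ℝ => Real.exp (-(c * t))) (-c) 0 := by
      simpa using (((hasDerivAt_id (0 : ℝ)).const_mul c).neg).exp
    have h := hderiv.tendsto_slope_zero_right.comp
      (tendsto_inv_atTop_nhdsGT_zero.comp (tendsto_natCast_atTop_atTop (R := ℝ)))
    refine h.congr fun n => ?_
    simp [div_eq_mul_inv]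
  have hexp (n k : ℕ) : Real.exp (-(s / n * q ^ k)) ≤ 1 :=
    Real.exp_le_one_iff.2 (neg_nonpos.2 (by positivity))
  have hsum (n : ℕ) : Summable fun k : ℕ => u ^ k * Real.exp (-(s / n * q ^ k)) :=
    hgeo.of_nonneg_of_le (fun k => by positivity)
      fun k => mul_le_of_le_one_right (by positivity) (hexp n k)
  have hlim : Tendsto
      (fun n : ℕ => ∑' k : ℕ, u ^ k * ((n : ℝ) * (Real.exp (-(s / n * q ^ k)) - 1))) atTop
      (nhds (∑' k : ℕ, u ^ k * (-(s * q ^ k)))) := by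
    refine tendsto_tsum_of_dominated_convergence (hgeo.mul_right s) (fun k => ?_) ?_
    · refine ((hpt (s * q ^ k)).const_mul (u ^ k)).congr fun n => ?_
      rw [mul_div_right_comm]
    · filter_upwards [eventually_gt_atTop 0] with n hn k
      have hn' : (0 : ℝ) < n := Nat.cast_pos.2 hn
      rw [Real.norm_eq_abs, abs_mul, abs_of_nonneg (pow_nonneg hu0 k)]
      refine mul_le_mul_of_nonneg_left ?_ (pow_nonneg hu0 k)
      rw [abs_of_nonpos (mul_nonpos_of_nonneg_of_nonpos hn'.le (sub_nonpos.2 (hexp n k)))]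
      have h1 := Real.add_one_le_exp (-(s / n * q ^ k))
      have h2 : (n : ℝ) * (s / n * q ^ k) = s * q ^ k := by field_simp
      have h3 : s * q ^ k ≤ s := mul_le_of_le_one_right hs (pow_le_one₀ hq0 hq1)
      nlinarith
  have hval : (1 - u) * ∑' k : ℕ, u ^ k * (-(s * q ^ k)) = -(s * ((1 - u) / (1 - u * q))) := by
    have h : (fun k : ℕ => u ^ k * (-(s * q ^ k))) = fun k => -s * (u * q) ^ k := by
      ext k; rw [mul_pow]; ring
    rw [h, tsum_mul_left, tsum_geometric_of_lt_one (by positivity) huq]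
    ring
  have hmain := hlim.const_mul (1 - u)
  rw [hval] at hmain
  have hstep (n : ℕ) : (1 - u) * ∑' k : ℕ, u ^ k * ((n : ℝ) * (Real.exp (-(s / n * q ^ k)) - 1)) =
      n * ((1 - u) * ∑' k : ℕ, u ^ k * Real.exp (-(s / n * q ^ k)) - 1) := by
    have h : (fun k : ℕ => u ^ k * ((n : ℝ) * (Real.exp (-(s / n * q ^ k)) - 1))) =
        fun k => n * (u ^ k * Real.exp (-(s / n * q ^ k)) - u ^ k) := by
      ext k; ring
    rw [h, tsum_mul_left, (hsum n).tsum_sub hgeo, tsum_geometric_of_lt_one hu0 hu1]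
    have : 1 - u ≠ 0 := (sub_pos.2 hu1).ne'
    field_simp
  simp only [hstep] at hmain
  simpa using Real.tendsto_one_add_pow_exp_of_tendsto hmain

/-- The mass of the ball of radius `p ^ a` under the density `rho` at a positive time. -/
lemma setIntegral_rho (p : ℕ) [Fact p.Prime]
    [MeasurableSpace ℚ_[p]] [BorelSpace ℚ_[p]]
    (μ : Measure ℚ_[p]) [μ.IsAddHaarMeasure]
    (hμ : μ {x : ℚ_[p] | ‖x‖ ≤ 1} = 1)
    {σ b t : ℝ} (hσ : 0 < σ) (hb : 0 < b) (ht : 0 < t) (a : ℤ) :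
    ∫ x in {x : ℚ_[p] | ‖x‖ ≤ (p : ℝ) ^ a}, rho p σ b t x ∂μ =
      (1 - (p : ℝ)⁻¹) * ∑' k : ℕ, (p : ℝ)⁻¹ ^ k *
        Real.exp (-(σ * t * (p : ℝ) ^ (-((a : ℝ) * b)) * (p : ℝ) ^ (-((k : ℝ) * b)))) := by
  have hp1 : (1 : ℝ) < p := Nat.one_lt_cast.2 (Fact.out : p.Prime).one_lt
  have hp0 : (0 : ℝ) < p := zero_lt_one.trans hp1
  set s : ℝ := σ * t * (p : ℝ) ^ (-((a : ℝ) * b)) with hs_def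
  have hs : 0 < s := by positivity
  set c : ℤ → ℝ := fun r => (Real.exp (-(σ * t * (p : ℝ) ^ ((r : ℝ) * b))) -
      Real.exp (-(σ * t * (p : ℝ) ^ (((r : ℝ) + 1) * b)))) * (p : ℝ) ^ (r : ℤ) with hc
  set F : ℤ → ℚ_[p] → ℝ := fun r x => c r *
    Set.indicator {y : ℚ_[p] | ‖y‖ ≤ (p : ℝ) ^ (-r : ℤ)} (fun _ => 1) x with hF
  have hc0 (r : ℤ) : 0 ≤ c r := by
    refine mul_nonneg (sub_nonneg.2 (Real.exp_le_exp.2 (neg_le_neg ?_))) (by positivity)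
    refine mul_le_mul_of_nonneg_left (Real.rpow_le_rpow_of_exponent_le hp1.le ?_) (by positivity)
    gcongr
    linarith
  have hint (r : ℤ) : IntegrableOn (F r) {x : ℚ_[p] | ‖x‖ ≤ (p : ℝ) ^ a} μ := by
    refine Integrable.const_mul ?_ _
    refine Integrable.indicator ?_ (Padic.measurableSet_setOf_norm_le p _)
    exact integrableOn_const (Padic.measure_setOf_norm_le_ne_top p μ _)
  have hval (r : ℤ) : ∫ x in {x : ℚ_[p] | ‖x‖ ≤ (p : ℝ) ^ a}, F r x ∂μ =
      c r * (p : ℝ) ^ (min (-r) a) := by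
    simp only [hF]
    rw [integral_const_mul, integral_indicator_const (1 : ℝ) (Padic.measurableSet_setOf_norm_le p _),
      smul_eq_mul, mul_one, measureReal_restrict_apply (Padic.measurableSet_setOf_norm_le p _)]
    have hinter : {y : ℚ_[p] | ‖y‖ ≤ (p : ℝ) ^ (-r : ℤ)} ∩ {x : ℚ_[p] | ‖x‖ ≤ (p : ℝ) ^ a} =
        {x : ℚ_[p] | ‖x‖ ≤ (p : ℝ) ^ (min (-r) a)} := by
      have hmono : Monotone fun m : ℤ => (p : ℝ) ^ m := zpow_right_mono₀ hp1.le
      ext x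
      simp only [Set.mem_inter_iff, Set.mem_ofPred_eq]
      rw [← le_min_iff, ← hmono.map_min]
    rw [hinter, Padic.measureReal_setOf_norm_le_zpow p μ hμ]
  have hF0 (r : ℤ) (x : ℚ_[p]) : 0 ≤ F r x :=
    mul_nonneg (hc0 r) (Set.indicator_nonneg (fun _ _ => zero_le_one) x)
  have hsum : HasSum (fun r : ℤ => c r * (p : ℝ) ^ (min (-r) a))
      ((1 - (p : ℝ)⁻¹) * ∑' k : ℕ, (p : ℝ)⁻¹ ^ k *
        Real.exp (-(s * (p : ℝ) ^ (-((k : ℝ) * b))))) := by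
    rw [← (Equiv.subRight a).hasSum_iff]
    convert hasSum_exp_sub_exp_mul_zpow_min hp1 hb hs using 2 with m
    have e (y : ℝ) : s * (p : ℝ) ^ (y * b) = σ * t * (p : ℝ) ^ ((y - a) * b) := by
      rw [hs_def, mul_assoc, ← Real.rpow_add hp0]
      congr 2
      ring
    simp only [Function.comp_apply, Equiv.subRight_apply, hc]
    rw [e, e, mul_assoc, ← zpow_add₀ hp0.ne']
    push_cast
    congr 2
    · ring_nf
    · lia
  have hnorm : Summable fun r : ℤ =>
      ∫ x in {x : ℚ_[p] | ‖x‖ ≤ (p : ℝ) ^ a}, ‖F r x‖ ∂μ := by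
    simpa only [Real.norm_of_nonneg (hF0 _ _), hval] using hsum.summable
  have h := integral_tsum_of_summable_integral_norm hint hnorm
  simp only [hval, hsum.tsum_eq] at h
  exact h.symm

/-- For every real `T > 0` and every integer `a`,
`lim_{n→∞} (∫_{B_a} ρ(T/n,x) dμ(x))^n = exp(−σ·α·T·p^{−ab})`, where
`α = 1 − (p^b − 1)/(p^{b+1} − 1)`.  This limit is the probability that a p-adic
Brownian path with diffusion constant `σ` and Vladimirov exponent `b`, started at `0`,
remains in the ball `B_a` up to time `T`. -/
theorem exit_prob_statement_10 (p : ℕ) [Fact p.Prime]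
    [MeasurableSpace ℚ_[p]] [BorelSpace ℚ_[p]]
    (μ : Measure ℚ_[p]) [μ.IsAddHaarMeasure]
    (hμ : μ {x : ℚ_[p] | ‖x‖ ≤ 1} = 1)
    (σ b : ℝ) (hσ : 0 < σ) (hb : 0 < b)
    (T : ℝ) (hT : 0 < T) (a : ℤ) :
    Tendsto
      (fun n : ℕ =>
        (∫ x in {x : ℚ_[p] | ‖x‖ ≤ (p : ℝ) ^ a}, rho p σ b (T / n) x ∂μ) ^ n)
      atTop
      (nhds (Real.exp (-(σ * (1 - ((p : ℝ) ^ b - 1) / ((p : ℝ) ^ (b + 1) - 1)) * T *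
        (p : ℝ) ^ (-((a : ℝ) * b)))))) := by
  have hp1 : (1 : ℝ) < p := Nat.one_lt_cast.2 (Fact.out : p.Prime).one_lt
  have hp0 : (0 : ℝ) < p := zero_lt_one.trans hp1
  have hq1 : (p : ℝ) ^ (-b) ≤ 1 := Real.rpow_le_one_of_one_le_of_nonpos hp1.le (by linarith)
  have h := tendsto_geometric_exp_pow (u := (p : ℝ)⁻¹) (q := (p : ℝ) ^ (-b))
    (s := σ * T * (p : ℝ) ^ (-((a : ℝ) * b))) (by positivity) (inv_lt_one_of_one_lt₀ hp1)
    (by positivity) hq1 (by positivity)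
  have hconst : σ * T * (p : ℝ) ^ (-((a : ℝ) * b)) *
        ((1 - (p : ℝ)⁻¹) / (1 - (p : ℝ)⁻¹ * (p : ℝ) ^ (-b))) =
      σ * (1 - ((p : ℝ) ^ b - 1) / ((p : ℝ) ^ (b + 1) - 1)) * T *
        (p : ℝ) ^ (-((a : ℝ) * b)) := by
    have hpb : (1 : ℝ) < (p : ℝ) ^ b := Real.one_lt_rpow hp1 hb
    have hne : (p : ℝ) ^ b * p - 1 ≠ 0 := by nlinarith
    have hfrac : (1 - (p : ℝ)⁻¹) / (1 - (p : ℝ)⁻¹ * (p : ℝ) ^ (-b)) =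
        1 - ((p : ℝ) ^ b - 1) / ((p : ℝ) ^ (b + 1) - 1) := by
      rw [Real.rpow_add_one hp0.ne', Real.rpow_neg hp0.le]
      have hpb0 : (p : ℝ) ^ b ≠ 0 := by positivity
      have hden : 1 - (p : ℝ)⁻¹ * ((p : ℝ) ^ b)⁻¹ = ((p : ℝ) ^ b * p - 1) / ((p : ℝ) ^ b * p) := by
        field_simp
      rw [hden, eq_sub_iff_add_eq, div_div_eq_mul_div, ← add_div, div_eq_one_iff_eq hne]
      field_simp
      ring
    rw [hfrac]
    ring
  rw [hconst] at h
  refine h.congr' ?_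
  filter_upwards [eventually_gt_atTop 0] with n hn
  have hn' : (0 : ℝ) < n := Nat.cast_pos.2 hn
  rw [setIntegral_rho p μ hμ hσ hb (div_pos hT hn')]
  congr 3
  ext k
  rw [← Real.rpow_mul_natCast hp0.le]
  congr 3
  ring_nf
end
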